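/- arXiv:1912.03377 — 2 statements merged into one kernel-verified Lean document; each statement's English description precedes it below -/
import Mathlib

section
/- Let S be a cancellative semigroup (both left- and right-cancellative) admitting a right-invariant mean. Then S is embeddable into a group: there exist a group G and an injective semigroup homomorphism S → G. -/
noncomputable section

/-- A function `S → ℝ` is bounded, i.e. belongs to `ℓ∞(S)`. -/
def Bddf {S : Type*} (φ : S → ℝ) : Prop := ∃ C : ℝ, ∀ x, |φ x| ≤ C

/-- A mean on a semigroup `S`: a positive linear functional on `ℓ∞(S)` with
`M(1) = 1`.  (Its values on unbounded functions are irrelevant.) -/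
structure Mean (S : Type*) [Mul S] where
  toFun : (S → ℝ) → ℝ
  map_add : ∀ φ ψ : S → ℝ, Bddf φ → Bddf ψ → toFun (φ + ψ) = toFun φ + toFun ψ
  map_smul : ∀ (c : ℝ) (φ : S → ℝ), Bddf φ → toFun (c • φ) = c * toFun φ
  nonneg : ∀ φ : S → ℝ, Bddf φ → (∀ x, 0 ≤ φ x) → 0 ≤ toFun φ
  norm_one : toFun (fun _ => 1) = 1

/-- A mean is right-invariant if `M(x ↦ φ(x·s)) = M(φ)` for all `s`. -/
def Mean.RightInvariant {S : Type*} [Mul S] (M : Mean S) : Prop :=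
  ∀ (s : S) (φ : S → ℝ), Bddf φ → M.toFun (fun x => φ (x * s)) = M.toFun φ

/-- A mean is left-invariant if `M(x ↦ φ(s·x)) = M(φ)` for all `s`. -/
def Mean.LeftInvariant {S : Type*} [Mul S] (M : Mean S) : Prop :=
  ∀ (s : S) (φ : S → ℝ), Bddf φ → M.toFun (fun x => φ (s * x)) = M.toFun φ

lemma Bddf.indicator_one {S : Type*} (A : Set S) : Bddf (A.indicator (fun _ => (1 : ℝ))) := by
  refine ⟨1, fun x => ?_⟩
  by_cases h : x ∈ A <;> simp [h]

/-- A right-invariant mean gives full mass to every principal left ideal. -/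
lemma Mean.RightInvariant.toFun_indicator_range {S : Type*} [Mul S] {M : Mean S}
    (hM : M.RightInvariant) (a : S) :
    M.toFun ((Set.range (· * a)).indicator (fun _ => 1)) = 1 := by
  rw [← hM a _ (Bddf.indicator_one _)]
  simpa using M.norm_one

/-- Any two elements have a common left multiple if there is a right-invariant mean. -/
lemma Mean.RightInvariant.exists_mul_eq_mul {S : Type*} [Mul S] {M : Mean S}
    (hM : M.RightInvariant) (a b : S) : ∃ u v : S, u * a = v * b := by
  by_contra! h
  set A : Set S := Set.range (· * a)
  set B : Set S := Set.range (· * b)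
  have hAB : Disjoint A B := by
    rw [Set.disjoint_left]
    rintro _ ⟨u, rfl⟩ ⟨v, hv⟩
    exact h u v hv.symm
  set f : S → ℝ := A.indicator (fun _ => 1) + B.indicator (fun _ => 1)
  have hf : f = (A ∪ B).indicator (fun _ => 1) := (Set.indicator_union_of_disjoint hAB fun _ => (1 : ℝ)).symm
  have hfb : Bddf f := hf ▸ Bddf.indicator_one _
  have hfM : M.toFun f = 2 := by
    rw [M.map_add _ _ (Bddf.indicator_one _) (Bddf.indicator_one _),
      hM.toFun_indicator_range, hM.toFun_indicator_range]
    norm_num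
  have hg : (fun _ => 1 : S → ℝ) = f + (A ∪ B)ᶜ.indicator (fun _ => 1) := by
    rw [hf, Set.indicator_self_add_compl]
  have hpos : 0 ≤ M.toFun ((A ∪ B)ᶜ.indicator (fun _ => 1)) :=
    M.nonneg _ (Bddf.indicator_one _) fun x => Set.indicator_nonneg (fun _ _ => zero_le_one) x
  have hsum := M.norm_one
  rw [hg, M.map_add _ _ hfb (Bddf.indicator_one _)] at hsum
  linarith

/-- Adjoining a unit to a right-cancellative semigroup with common left multiples yields a left Ore
monoid. The result need not be cancellative, since the semigroup may already have a unit. -/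
@[reducible]
def WithOne.oreSetTop {S : Type*} [Semigroup S]
    (hrc : ∀ a x y : S, x * a = y * a → x = y)
    (hore : ∀ a b : S, ∃ u v : S, u * a = v * b) :
    OreLocalization.OreSet (⊤ : Submonoid (WithOne S)) := by
  have key : ∀ (r : WithOne S) (s : (⊤ : Submonoid (WithOne S))),
      ∃ (n : WithOne S) (d : (⊤ : Submonoid (WithOne S))), d * r = n * s := by
    rintro r ⟨s, hs⟩
    induction r with
    | one => exact ⟨1, ⟨s, hs⟩, by simp⟩
    | coe r =>
      induction s with
      | one => exact ⟨r, 1, by simp⟩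
      | coe s =>
        obtain ⟨u, v, h⟩ := hore r s
        exact ⟨v, ⟨u, trivial⟩, by simp [← WithOne.coe_mul, h]⟩
  choose n d h using key
  refine ⟨?_, n, d, h⟩
  rintro r₁ r₂ ⟨s, hs⟩ h
  refine ⟨⟨s, hs⟩, ?_⟩
  induction s with
  | one => simpa using h
  | coe s =>
    induction r₁ with
    | one =>
      induction r₂ with
      | one => rfl
      | coe b =>
        simp only [one_mul, ← WithOne.coe_mul, WithOne.coe_inj, mul_one] at h ⊢
        exact hrc s _ _ (by rw [mul_assoc, ← h])
    | coe a =>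
      induction r₂ with
      | one =>
        simp only [one_mul, ← WithOne.coe_mul, WithOne.coe_inj, mul_one] at h ⊢
        exact hrc s _ _ (by rw [mul_assoc, h])
      | coe b =>
        simp only [← WithOne.coe_mul, WithOne.coe_inj] at h ⊢
        rw [hrc s _ _ h]

/-- Ore's embedding theorem for right-amenable semigroups: a cancellative
semigroup admitting a right-invariant mean embeds into a group. -/
theorem cancellative_right_amenable_embeds {S : Type u} [Semigroup S]
    (hlc : ∀ a x y : S, a * x = a * y → x = y)
    (hrc : ∀ a x y : S, x * a = y * a → x = y)
    (hM : ∃ M : Mean S, M.RightInvariant) :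
    ∃ (G : Type u) (_ : Group G) (f : S →ₙ* G), Function.Injective f := by
  obtain ⟨M, hM⟩ := hM
  let _ := WithOne.oreSetTop hrc hM.exists_mul_eq_mul
  let num := OreLocalization.numeratorHom (R := WithOne S) (S := ⊤)
  have hnum : ∀ r, IsUnit (num r) := fun r =>
    OreLocalization.numerator_isUnit (⟨r, trivial⟩ : (⊤ : Submonoid (WithOne S)))
  refine ⟨_, inferInstance,
    (IsUnit.liftRight num hnum).toMulHom.comp WithOne.coeMulHom, ?_⟩
  intro x y hxy
  replace hxy : num x = num y := congrArg Units.val hxy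
  obtain ⟨u, v, h₁, h₂⟩ := OreLocalization.oreDiv_eq_iff.mp hxy
  obtain ⟨u, hu⟩ := u
  simp only [OneMemClass.coe_one, mul_one, Submonoid.smul_def, smul_eq_mul] at h₁ h₂
  subst h₂
  induction u with
  | one => simpa using h₁.symm
  | coe u =>
    rw [← WithOne.coe_mul, ← WithOne.coe_mul, WithOne.coe_inj] at h₁
    exact (hlc u _ _ h₁).symm
end
end

section
/- Let S be a right-cancellative amenable semigroup such that every right-invariant mean on S is left-invariant, and let S₀ be a subsemigroup of S admitting a right-invariant mean. Then every right-invariant mean on S₀ is left-invariant. -/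
noncomputable section

theorem Bddf.comp {S T : Type*} {φ : S → ℝ} (h : Bddf φ) (f : T → S) :
    Bddf (fun t => φ (f t)) := by
  obtain ⟨C, hC⟩ := h
  exact ⟨C, fun t => hC (f t)⟩

theorem bddf_const {S : Type*} (c : ℝ) : Bddf (fun _ : S => c) := ⟨|c|, fun _ => le_rfl⟩

namespace Mean

variable {S : Type*}

theorem map_const [Mul S] (M : Mean S) (c : ℝ) : M.toFun (fun _ => c) = c := by
  have h := M.map_smul c (fun _ => 1) (bddf_const 1)
  rw [M.norm_one, mul_one] at h
  refine (congrArg M.toFun ?_).trans h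
  funext x
  simp

theorem le_of_forall_le [Mul S] (M : Mean S) {φ : S → ℝ} {C : ℝ} (hφ : Bddf φ)
    (h : ∀ x, φ x ≤ C) : M.toFun φ ≤ C := by
  obtain ⟨D, hD⟩ := hφ
  have hneg : Bddf (fun x => C - φ x) :=
    ⟨|C| + D, fun x => (abs_sub _ _).trans (by gcongr; exact hD x)⟩
  have hadd := M.map_add φ (fun x => C - φ x) ⟨D, hD⟩ hneg
  have hsum : φ + (fun x => C - φ x) = fun _ => C := by
    funext x
    simp
  rw [hsum, M.map_const] at hadd
  linarith [M.nonneg _ hneg fun x => sub_nonneg.2 (h x)]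

theorem abs_le [Mul S] (M : Mean S) {φ : S → ℝ} {C : ℝ} (h : ∀ x, |φ x| ≤ C) :
    |M.toFun φ| ≤ C := by
  have hφ : Bddf φ := ⟨C, h⟩
  have hneg : Bddf ((-1 : ℝ) • φ) := ⟨C, fun x => by simpa using h x⟩
  have h₁ := M.le_of_forall_le hφ fun x => (le_abs_self _).trans (h x)
  have h₂ := M.le_of_forall_le (C := C) hneg fun x => by
    simpa using (neg_le_abs (φ x)).trans (h x)
  rw [M.map_smul _ _ hφ] at h₂
  exact _root_.abs_le.2 ⟨by linarith, h₁⟩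

theorem bddf_apply_translate [Mul S] {S₀ : Subsemigroup S} (N : Mean S₀) {φ : S → ℝ}
    (hφ : Bddf φ) : Bddf (fun y => N.toFun (fun t => φ (t * y))) := by
  obtain ⟨C, hC⟩ := hφ
  exact ⟨C, fun y => N.abs_le fun t => hC _⟩

/-- The convolution of a mean on a subsemigroup with a mean on the whole semigroup:
`φ ↦ M_y (N_t (φ (t * y)))`. -/
def conv [Mul S] {S₀ : Subsemigroup S} (N : Mean S₀) (M : Mean S) : Mean S where
  toFun φ := M.toFun fun y => N.toFun fun t => φ (t * y)
  map_add φ ψ hφ hψ := by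
    rw [← M.map_add _ _ (N.bddf_apply_translate hφ) (N.bddf_apply_translate hψ)]
    congr 1
    funext y
    exact N.map_add _ _ (hφ.comp _) (hψ.comp _)
  map_smul c φ hφ := by
    rw [← M.map_smul _ _ (N.bddf_apply_translate hφ)]
    congr 1
    funext y
    exact N.map_smul _ _ (hφ.comp _)
  nonneg φ hφ h := M.nonneg _ (N.bddf_apply_translate hφ) fun y =>
    N.nonneg _ (hφ.comp _) fun t => h _
  norm_one := by simp only [map_const]

theorem conv_rightInvariant [Semigroup S] {S₀ : Subsemigroup S} (N : Mean S₀) {M : Mean S}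
    (hM : M.RightInvariant) : (N.conv M).RightInvariant := by
  intro s φ hφ
  have h := hM s _ (N.bddf_apply_translate hφ)
  simpa only [conv, mul_assoc] using h

/-- Principal left ideals of a semigroup with a right-invariant mean meet. -/
theorem RightInvariant.exists_mul_eq_mul_s11 [Mul S] {M : Mean S} (hM : M.RightInvariant)
    (a b : S) : ∃ u v : S, u * a = v * b := by
  classical
  by_contra! hne
  let f : S → ℝ := fun x => if ∃ u, u * a = x then 1 else 0
  let g : S → ℝ := fun x => if ∃ u, u * a = x then 0 else 1
  have hf : Bddf f := ⟨1, fun x => by dsimp only [f]; split_ifs <;> simp⟩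
  have hg : Bddf g := ⟨1, fun x => by dsimp only [g]; split_ifs <;> simp⟩
  have hMf : M.toFun f = 1 := by
    rw [← hM a f hf, ← M.norm_one]
    congr 1
    funext x
    exact if_pos ⟨x, rfl⟩
  have hMg : M.toFun g = 1 := by
    rw [← hM b g hg, ← M.norm_one]
    congr 1
    funext x
    exact if_neg fun ⟨u, hu⟩ => hne u x hu
  have hfg : f + g = fun _ => 1 := by
    funext x
    simp only [f, g, Pi.add_apply]
    split_ifs <;> simp
  have h := M.map_add f g hf hg
  rw [hfg, M.norm_one, hMf, hMg] at h
  norm_num at h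

end Mean

/-- Two elements are related when their orbits under left multiplication by `S₀` meet. -/
def orbitMeetSetoid {S : Type*} [Semigroup S] (S₀ : Subsemigroup S) [Nonempty S₀]
    (hore : ∀ a b : S₀, ∃ u v : S₀, u * a = v * b) : Setoid S where
  r x y := ∃ a b : S₀, (a : S) * x = b * y
  iseqv :=
    { refl := fun _ => ⟨Classical.arbitrary _, Classical.arbitrary _, rfl⟩
      symm := fun ⟨a, b, h⟩ => ⟨b, a, h.symm⟩
      trans := by
        rintro x y z ⟨a, b, h⟩ ⟨c, d, h'⟩
        obtain ⟨u, v, huv⟩ := hore b c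
        have huv' : (u : S) * b = v * c := congrArg Subtype.val huv
        refine ⟨u * a, v * d, ?_⟩
        rw [MulMemClass.coe_mul, MulMemClass.coe_mul, mul_assoc, h, ← mul_assoc, huv',
          mul_assoc, h', mul_assoc] }

/-- A bounded function on `S₀` can be copied onto one orbit `S₀ * z` in each class of orbits
of left multiplication by `S₀`. -/
theorem exists_bddf_extension {S : Type*} [Semigroup S]
    (hrc : ∀ a x y : S, x * a = y * a → x = y) (S₀ : Subsemigroup S) [Nonempty S₀]
    (hore : ∀ a b : S₀, ∃ u v : S₀, u * a = v * b) {ψ : S₀ → ℝ} (hψ : Bddf ψ) :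
    ∃ φ : S → ℝ, Bddf φ ∧
      ∀ y : S, ∃ (a b : S₀) (z : S), (a : S) * y = b * z ∧ ∀ t : S₀, φ (t * z) = ψ t := by
  classical
  let R := orbitMeetSetoid S₀ hore
  let φ : S → ℝ := fun x =>
    if h : ∃ (t : S₀) (q : Quotient R), (t : S) * q.out = x then ψ h.choose else 0
  obtain ⟨C, hC⟩ := hψ
  refine ⟨φ, ⟨C, fun x => ?_⟩, fun y => ?_⟩
  · dsimp only [φ]
    split_ifs with h
    · exact hC _
    · simpa using (abs_nonneg _).trans (hC (Classical.arbitrary S₀))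
  · obtain ⟨b, a, hab⟩ : R.r (Quotient.mk R y).out y := Quotient.mk_out (s := R) y
    refine ⟨a, b, (Quotient.mk R y).out, hab.symm, fun t => ?_⟩
    have h : ∃ (t' : S₀) (q : Quotient R),
        (t' : S) * q.out = t * (Quotient.mk R y).out := ⟨t, _, rfl⟩
    obtain ⟨q, hq⟩ := h.choose_spec
    have hqy : q = Quotient.mk R y := by
      rw [← Quotient.out_equiv_out]
      exact ⟨_, _, hq⟩
    rw [hqy] at hq
    have ht : h.choose = t := Subtype.ext (hrc _ _ _ hq)
    simp only [φ, dif_pos h, ht]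

/-- Granirer's corollary: in a right-cancellative amenable semigroup in which
every right-invariant mean is left-invariant, every right-amenable
subsemigroup has the same property: each of its right-invariant means is
left-invariant. -/
theorem subsemigroup_rim_subset_lim {S : Type*} [Semigroup S]
    (hrc : ∀ a x y : S, x * a = y * a → x = y)
    (ham : ∃ M : Mean S, M.RightInvariant ∧ M.LeftInvariant)
    (hRL : ∀ M : Mean S, M.RightInvariant → M.LeftInvariant)
    (S₀ : Subsemigroup S)
    (hM₀ : ∃ M : Mean S₀, M.RightInvariant) :
    ∀ M : Mean S₀, M.RightInvariant → M.LeftInvariant := by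
  intro N hN s ψ hψ
  obtain ⟨M, hMr, -⟩ := ham
  have : Nonempty S₀ := ⟨s⟩
  obtain ⟨φ, hφ, hφψ⟩ := exists_bddf_extension hrc S₀ hN.exists_mul_eq_mul_s11 hψ
  have hright (y : S) : N.toFun (fun t => φ (t * y)) = N.toFun ψ := by
    obtain ⟨a, b, z, hab, hz⟩ := hφψ y
    rw [← hN a _ (hφ.comp _), ← hN b ψ hψ]
    congr 1
    funext t
    rw [← hz, MulMemClass.coe_mul, MulMemClass.coe_mul, mul_assoc, hab, mul_assoc]
  have hleft (y : S) :
      N.toFun (fun t => φ (s * (t * y))) = N.toFun (fun t => ψ (s * t)) := by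
    obtain ⟨a, b, z, hab, hz⟩ := hφψ y
    rw [← hN a _ (hφ.comp _), ← hN b _ (hψ.comp _)]
    congr 1
    funext t
    rw [← hz]
    simp only [MulMemClass.coe_mul, mul_assoc, hab]
  have h := hRL _ (N.conv_rightInvariant hMr) s φ hφ
  simpa only [Mean.conv, hright, hleft, Mean.map_const] using h
end
end
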